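/- Uniform decay of the scale factors under local bounds on η: Assume condition (C2): |η| and 1/|η| are locally bounded functions on I. For N ∈ ℕ define a_N(y) := sup{a ∈ [0,∞) : G_y(a) ≤ 1/N} for y ∈ I, and assume a_N(y) < ∞ for all N and y. Then: (a) for every y ∈ I, a_N(y) decreases to 0 as N → ∞, and limsup_{N→∞} N·a_N(y)² ≤ (limsup_{z→y} η(z)²)/(∫ x² μ(dx)) (with the convention c/∞ = 0); (b) for every compact interval K ⊂ I, lim_{N→∞} sup_{y ∈ K} a_N(y) = 0. -/

import Mathlib

open MeasureTheory Filter Set Topology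
open scoped ENNReal

/-- The integrand `2/η(z)²`, valued in `[0,∞]` (it equals `∞` where `η` vanishes). -/
noncomputable def qIntegrand (η : ℝ → ℝ) (z : ℝ) : ℝ≥0∞ :=
  2 / ENNReal.ofReal ((η z) ^ 2)

/-- `q(y,x) = ∫_y^x ∫_y^u 2/η(z)² dz du ∈ [0,∞]`, the oriented iterated integral (nonnegative
also for `x < y`, since both orientations flip). -/
noncomputable def qfun (η : ℝ → ℝ) (y x : ℝ) : ℝ≥0∞ :=
  if y ≤ x then ∫⁻ u in Set.Ioc y x, ∫⁻ z in Set.Ioc y u, qIntegrand η z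
  else ∫⁻ u in Set.Ioc x y, ∫⁻ z in Set.Ioc u y, qIntegrand η z

/-- `G_y(a) = ∫_ℝ q(y, y + a x) μ(dx) ∈ [0,∞]`. -/
noncomputable def Gfun (η : ℝ → ℝ) (μ : Measure ℝ) (y a : ℝ) : ℝ≥0∞ :=
  ∫⁻ x, qfun η y (y + a * x) ∂μ

/-- The scale factor `a_N(y) = sup {a ≥ 0 : G_y(a) ≤ 1/N}`. -/
noncomputable def scaleFactor (η : ℝ → ℝ) (μ : Measure ℝ) (N : ℕ) (y : ℝ) : ℝ :=
  sSup {a : ℝ | 0 ≤ a ∧ Gfun η μ y a ≤ 1 / (N : ℝ≥0∞)}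

lemma lintegral_Ioc_ofReal_sub_left (y m : ℝ) (hm : 0 ≤ m) :
    ∫⁻ u in Ioc y (y + m), ENNReal.ofReal (u - y) = ENNReal.ofReal (m ^ 2 / 2) := by
  rw [← ofReal_integral_eq_lintegral_ofReal,
    ← intervalIntegral.integral_of_le (by linarith),
    intervalIntegral.integral_comp_sub_right (fun u => u) y, integral_id]
  · congr 1; ring
  · exact (Continuous.integrableOn_Icc (by fun_prop)).mono_set Ioc_subset_Icc_self
  · exact (ae_restrict_mem measurableSet_Ioc).mono fun u hu => sub_nonneg.2 hu.1.le

lemma lintegral_Ioc_ofReal_sub_right (y m : ℝ) (hm : 0 ≤ m) :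
    ∫⁻ u in Ioc (y - m) y, ENNReal.ofReal (y - u) = ENNReal.ofReal (m ^ 2 / 2) := by
  rw [← ofReal_integral_eq_lintegral_ofReal,
    ← intervalIntegral.integral_of_le (by linarith),
    intervalIntegral.integral_comp_sub_left (fun u => u) y, integral_id]
  · congr 1; ring
  · exact (Continuous.integrableOn_Icc (by fun_prop)).mono_set Ioc_subset_Icc_self
  · exact (ae_restrict_mem measurableSet_Ioc).mono fun u hu => sub_nonneg.2 hu.2

/-- If `η² ≤ B` on `[y - δ, y + δ]`, then `q(y, ·)` dominates a truncated parabola. -/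
lemma ofReal_sq_div_le_qfun {η : ℝ → ℝ} {y δ B : ℝ} (hB : 0 < B) (hδ : 0 ≤ δ)
    (h : ∀ z, |z - y| ≤ δ → η z ^ 2 ≤ B) (x : ℝ) :
    ENNReal.ofReal (min |x - y| δ ^ 2 / B) ≤ qfun η y x := by
  set m := min |x - y| δ with hm
  have hm0 : 0 ≤ m := le_min (abs_nonneg _) hδ
  have hmδ : m ≤ δ := min_le_right _ _
  have hmx : m ≤ |x - y| := min_le_left _ _
  have hq : ∀ z, |z - y| ≤ δ → ENNReal.ofReal (2 / B) ≤ qIntegrand η z := by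
    intro z hz
    rw [qIntegrand, ENNReal.ofReal_div_of_pos hB, ENNReal.ofReal_ofNat]
    exact ENNReal.div_le_div_left (ENNReal.ofReal_le_ofReal (h z hz)) 2
  have hconst : ENNReal.ofReal (m ^ 2 / B)
      = ENNReal.ofReal (2 / B) * ENNReal.ofReal (m ^ 2 / 2) := by
    rw [← ENNReal.ofReal_mul (by positivity)]
    congr 1
    field_simp
  have hinner : ∀ a b : ℝ, (∀ z ∈ Ioc a b, |z - y| ≤ δ) →
      ENNReal.ofReal (2 / B) * ENNReal.ofReal (b - a) ≤ ∫⁻ z in Ioc a b, qIntegrand η z := by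
    intro a b hab
    rw [← Real.volume_Ioc, ← setLIntegral_const]
    exact setLIntegral_mono' measurableSet_Ioc fun z hz => hq z (hab z hz)
  rw [hconst, qfun]
  split_ifs with hyx
  · rw [abs_of_nonneg (sub_nonneg.2 hyx)] at hmx
    rw [← lintegral_Ioc_ofReal_sub_left y m hm0, ← lintegral_const_mul _ (by fun_prop)]
    refine (setLIntegral_mono' measurableSet_Ioc fun u hu => hinner y u fun z hz => ?_).trans
      (lintegral_mono_set (Ioc_subset_Ioc_right (by linarith)))
    rw [abs_of_nonneg (sub_nonneg.2 hz.1.le)]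
    linarith [hz.2, hu.2]
  · rw [abs_of_nonpos (by linarith)] at hmx
    rw [← lintegral_Ioc_ofReal_sub_right y m hm0, ← lintegral_const_mul _ (by fun_prop)]
    refine (setLIntegral_mono' measurableSet_Ioc fun u hu => hinner u y fun z hz => ?_).trans
      (lintegral_mono_set (Ioc_subset_Ioc_left (by linarith)))
    rw [abs_of_nonpos (sub_nonpos.2 hz.2)]
    linarith [hz.1, hu.1]

/-- The second moment of `μ` truncated at level `n`. -/
noncomputable def truncSecondMoment (μ : Measure ℝ) (n : ℕ) : ℝ≥0∞ :=
  ∫⁻ x, ENNReal.ofReal (min |x| (n : ℝ) ^ 2) ∂μ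

lemma ofReal_mul_truncSecondMoment_le_Gfun {η : ℝ → ℝ} {μ : Measure ℝ} {y δ B a e : ℝ} {n : ℕ}
    (hB : 0 < B) (hδ : 0 ≤ δ) (h : ∀ z, |z - y| ≤ δ → η z ^ 2 ≤ B) (he : 0 ≤ e)
    (hea : e ≤ a) (hen : e * n ≤ δ) :
    ENNReal.ofReal (e ^ 2 / B) * truncSecondMoment μ n ≤ Gfun η μ y a := by
  rw [truncSecondMoment, ← lintegral_const_mul _ (by fun_prop), Gfun]
  refine lintegral_mono fun x => ?_
  refine le_trans ?_ (ofReal_sq_div_le_qfun hB hδ h (y + a * x))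
  rw [← ENNReal.ofReal_mul (by positivity)]
  apply ENNReal.ofReal_le_ofReal
  rw [div_mul_eq_mul_div, ← mul_pow]
  have hmin : e * min |x| (n : ℝ) ≤ min |y + a * x - y| δ := by
    rw [add_sub_cancel_left, abs_mul, abs_of_nonneg (he.trans hea)]
    exact le_min (mul_le_mul hea (min_le_left _ _) (by positivity) (he.trans hea))
      ((mul_le_mul_of_nonneg_left (min_le_right _ _) he).trans hen)
  gcongr

lemma truncSecondMoment_ne_top (μ : Measure ℝ) [IsProbabilityMeasure μ] (n : ℕ) :
    truncSecondMoment μ n ≠ ⊤ := by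
  refine ne_top_of_le_ne_top (b := ENNReal.ofReal ((n : ℝ) ^ 2)) ENNReal.ofReal_ne_top ?_
  calc truncSecondMoment μ n ≤ ∫⁻ _, ENNReal.ofReal ((n : ℝ) ^ 2) ∂μ := by
        refine lintegral_mono fun x => ENNReal.ofReal_le_ofReal ?_
        have := min_le_right |x| (n : ℝ)
        gcongr
    _ = ENNReal.ofReal ((n : ℝ) ^ 2) := by simp

lemma truncSecondMoment_ne_zero {μ : Measure ℝ} [IsProbabilityMeasure μ]
    (hμ : μ ≠ Measure.dirac 0) {n : ℕ} (hn : n ≠ 0) : truncSecondMoment μ n ≠ 0 := by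
  intro h0
  rw [truncSecondMoment, lintegral_eq_zero_iff (by fun_prop)] at h0
  have hid : (id : ℝ → ℝ) =ᵐ[μ] fun _ => 0 := by
    filter_upwards [h0] with x hx
    by_contra hne
    have hpos : 0 < min |x| (n : ℝ) := lt_min (abs_pos.2 hne) (by positivity)
    exact absurd hx (ENNReal.ofReal_pos.2 (by positivity)).ne'
  apply hμ
  have : μ.map id = μ.map fun _ => (0 : ℝ) := Measure.map_congr hid
  rwa [Measure.map_id, Measure.map_const, measure_univ, one_smul] at this

lemma iSup_truncSecondMoment (μ : Measure ℝ) :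
    ⨆ n, truncSecondMoment μ n = ∫⁻ x, ENNReal.ofReal (x ^ 2) ∂μ := by
  unfold truncSecondMoment
  rw [← lintegral_iSup (fun n => by fun_prop)]
  · refine lintegral_congr fun x => le_antisymm (iSup_le fun n => ?_) ?_
    · rw [← sq_abs x]
      have := min_le_left |x| (n : ℝ)
      apply ENNReal.ofReal_le_ofReal
      gcongr
    · obtain ⟨n, hn⟩ := exists_nat_ge |x|
      refine le_iSup_of_le n ?_
      rw [min_eq_left hn, sq_abs]
  · intro n m hnm x
    have : (n : ℝ) ≤ m := by exact_mod_cast hnm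
    apply ENNReal.ofReal_le_ofReal
    gcongr

lemma zero_mem_scaleFactor_set (η : ℝ → ℝ) (μ : Measure ℝ) (N : ℕ) (y : ℝ) :
    (0 : ℝ) ∈ {a : ℝ | 0 ≤ a ∧ Gfun η μ y a ≤ 1 / (N : ℝ≥0∞)} := by
  simp [Gfun, qfun]

lemma scaleFactor_nonneg (η : ℝ → ℝ) (μ : Measure ℝ) (N : ℕ) (y : ℝ) :
    0 ≤ scaleFactor η μ N y :=
  Real.sSup_nonneg fun _ ha => ha.1

/-- The scale factors decay at a rate depending only on a local upper bound for `η²`. -/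
lemma eventually_forall_scaleFactor_le {η : ℝ → ℝ} {μ : Measure ℝ} [IsProbabilityMeasure μ]
    (hμ : μ ≠ Measure.dirac 0) {δ B ε : ℝ} (hB : 0 < B) (hδ : 0 < δ) (hε : 0 < ε) :
    ∀ᶠ N : ℕ in atTop, ∀ y, (∀ z, |z - y| ≤ δ → η z ^ 2 ≤ B) →
      (∀ a, 0 ≤ a → Gfun η μ y a ≤ 1 / (N : ℝ≥0∞) → a ≤ ε) ∧ scaleFactor η μ N y ≤ ε := by
  set e := min ε δ
  have he : 0 < e := lt_min hε hδ
  have hpos : ENNReal.ofReal (e ^ 2 / B) * truncSecondMoment μ 1 ≠ 0 :=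
    mul_ne_zero (ENNReal.ofReal_pos.2 (by positivity)).ne'
      (truncSecondMoment_ne_zero hμ one_ne_zero)
  filter_upwards [ENNReal.tendsto_inv_nat_nhds_zero.eventually_lt_const (pos_iff_ne_zero.2 hpos)]
    with N hN y hy
  have hle : ∀ a, 0 ≤ a → Gfun η μ y a ≤ 1 / (N : ℝ≥0∞) → a ≤ ε := by
    intro a _ hG
    by_contra! hlt
    rw [one_div] at hG
    exact (((ofReal_mul_truncSecondMoment_le_Gfun hB hδ.le hy he.le
      ((min_le_left _ _).trans hlt.le) (by simp [e])).trans hG).trans_lt hN).false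
  exact ⟨hle, csSup_le ⟨0, zero_mem_scaleFactor_set η μ N y⟩ fun a ha => hle a ha.1 ha.2⟩

lemma limsup_scaleFactor_mul_truncSecondMoment_le {η : ℝ → ℝ} {μ : Measure ℝ}
    [IsProbabilityMeasure μ] (hμ : μ ≠ Measure.dirac 0) {y δ B : ℝ} (hB : 0 < B) (hδ : 0 < δ)
    (h : ∀ z, |z - y| ≤ δ → η z ^ 2 ≤ B)
    (hbdd : ∀ N : ℕ, 1 ≤ N → BddAbove {a : ℝ | 0 ≤ a ∧ Gfun η μ y a ≤ 1 / (N : ℝ≥0∞)}) (n : ℕ) :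
    limsup (fun N : ℕ => ENNReal.ofReal ((N : ℝ) * scaleFactor η μ N y ^ 2)) atTop
      * truncSecondMoment μ n ≤ ENNReal.ofReal B := by
  have hB' : ENNReal.ofReal B ≠ 0 := (ENNReal.ofReal_pos.2 hB).ne'
  rw [← ENNReal.le_div_iff_mul_le (Or.inr hB') (Or.inr ENNReal.ofReal_ne_top)]
  refine limsup_le_of_le (by isBoundedDefault) ?_
  filter_upwards [eventually_forall_scaleFactor_le hμ hB hδ
    (show 0 < δ / ((n : ℝ) + 1) by positivity), eventually_ge_atTop 1] with N hN hN1
  obtain ⟨hN, -⟩ := hN y h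
  rw [ENNReal.le_div_iff_mul_le (Or.inr hB') (Or.inr ENNReal.ofReal_ne_top)]
  have hclosed : IsClosed {a : ℝ | ENNReal.ofReal ((N : ℝ) * a ^ 2) * truncSecondMoment μ n
      ≤ ENNReal.ofReal B} := by
    refine isClosed_le ?_ continuous_const
    exact (ENNReal.continuous_mul_const (truncSecondMoment_ne_top μ n)).comp
      (ENNReal.continuous_ofReal.comp (by fun_prop))
  refine closure_minimal (fun a ha => ?_) hclosed
    (csSup_mem_closure ⟨0, zero_mem_scaleFactor_set η μ N y⟩ (hbdd N hN1))
  have haδ : a * n ≤ δ := by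
    have h1 := hN a ha.1 ha.2
    rw [le_div_iff₀ (by positivity)] at h1
    linarith [ha.1]
  have hG := (ofReal_mul_truncSecondMoment_le_Gfun (μ := μ) hB hδ.le h ha.1 le_rfl haδ).trans ha.2
  have hN0 : (N : ℝ≥0∞) ≠ 0 := by exact_mod_cast (by omega : N ≠ 0)
  calc ENNReal.ofReal ((N : ℝ) * a ^ 2) * truncSecondMoment μ n
      = (N : ℝ≥0∞) * ENNReal.ofReal B *
          (ENNReal.ofReal (a ^ 2 / B) * truncSecondMoment μ n) := by
        rw [← mul_assoc, mul_assoc (N : ℝ≥0∞), ← ENNReal.ofReal_mul hB.le,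
          mul_div_cancel₀ _ hB.ne', ENNReal.ofReal_mul (by positivity), ENNReal.ofReal_natCast]
    _ ≤ (N : ℝ≥0∞) * ENNReal.ofReal B * (1 / (N : ℝ≥0∞)) := by gcongr
    _ = ENNReal.ofReal B := by
        rw [mul_right_comm, ENNReal.mul_div_cancel hN0 (ENNReal.natCast_ne_top N), one_mul]

/-- **Uniform decay of the scale factors under local bounds on `η`** (condition (C2):
`|η|` and `1/|η|` are locally bounded on `I`; `a_N(y)` is assumed finite, i.e. the defining
set is bounded above).  Then:
(a) for every `y ∈ I` the sequence `a_N(y)` decreases to `0` as `N → ∞` and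
`limsup_N N·a_N(y)² ≤ (limsup_{z→y} η(z)²)/∫ x² μ(dx)` (with the convention `c/∞ = 0`);
(b) for every compact `K ⊆ I`, `sup_{y ∈ K} a_N(y) → 0` as `N → ∞`.
Here `I` is an open subinterval of `ℝ` (an open order-connected set). -/
theorem scale_factor_uniform_decay
    (I : Set ℝ) (hIopen : IsOpen I) (hIconn : I.OrdConnected)
    (η : ℝ → ℝ) (hηmeas : Measurable η)
    (hηne : ∀ x ∈ I, η x ≠ 0) (hηzero : ∀ x ∉ I, η x = 0)
    (hηloc : LocallyIntegrableOn (fun z => 1 / (η z) ^ 2) I volume)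
    (μ : Measure ℝ) [IsProbabilityMeasure μ]
    (hμint : Integrable (fun x => x) μ) (hμcen : ∫ x, x ∂μ = 0)
    (hμne : μ ≠ Measure.dirac 0)
    (hC2 : ∀ y ∈ I, ∃ ε > (0 : ℝ), ∃ C > (0 : ℝ), ∀ x ∈ I, |x - y| < ε →
      (|η x| ≤ C ∧ 1 / |η x| ≤ C))
    (hbdd : ∀ N : ℕ, 1 ≤ N → ∀ y ∈ I,
      BddAbove {a : ℝ | 0 ≤ a ∧ Gfun η μ y a ≤ 1 / (N : ℝ≥0∞)}) :
    (∀ y ∈ I,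
      (∀ N M : ℕ, 1 ≤ N → N ≤ M → scaleFactor η μ M y ≤ scaleFactor η μ N y) ∧
      Tendsto (fun N : ℕ => scaleFactor η μ N y) atTop (𝓝 0) ∧
      Filter.limsup (fun N : ℕ => ENNReal.ofReal ((N : ℝ) * (scaleFactor η μ N y) ^ 2)) atTop
        ≤ (Filter.limsup (fun z => ENNReal.ofReal ((η z) ^ 2)) (𝓝 y))
            / ∫⁻ x, ENNReal.ofReal (x ^ 2) ∂μ) ∧
    (∀ K : Set ℝ, K ⊆ I → IsCompact K → ∀ ε > (0 : ℝ), ∃ N₂ : ℕ, ∀ N : ℕ, N₂ ≤ N →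
      ∀ y ∈ K, scaleFactor η μ N y ≤ ε) := by
  have hloc : ∀ y ∈ I, ∃ ρ > (0 : ℝ), ∃ B > (0 : ℝ), ∀ z, |z - y| < ρ → η z ^ 2 ≤ B := by
    intro y hy
    obtain ⟨ρ, hρ, C, hC, hCη⟩ := hC2 y hy
    refine ⟨ρ, hρ, C ^ 2, by positivity, fun z hz => ?_⟩
    by_cases hzI : z ∈ I
    · rw [← sq_abs]
      have := (hCη z hzI hz).1
      gcongr
    · rw [hηzero z hzI, zero_pow two_ne_zero]
      positivity
  have hunif : ∀ K : Set ℝ, K ⊆ I → IsCompact K → ∀ ε > (0 : ℝ),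
      ∀ᶠ N : ℕ in atTop, ∀ y ∈ K, scaleFactor η μ N y ≤ ε := by
    intro K hKI hK ε hε
    refine hK.induction_on (p := fun K => ∀ᶠ N : ℕ in atTop, ∀ y ∈ K, scaleFactor η μ N y ≤ ε)
      (by simp) (fun s t hst ht => ht.mono fun N hN y hy => hN y (hst hy))
      (fun s t hs ht => ?_) (fun y hy => ?_)
    · filter_upwards [hs, ht] with N h1 h2 y hy
      exact hy.elim (h1 y) (h2 y)
    · obtain ⟨ρ, hρ, B, hB, hη⟩ := hloc y (hKI hy)
      refine ⟨Metric.ball y (ρ / 2),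
        mem_nhdsWithin_of_mem_nhds (Metric.ball_mem_nhds _ (by positivity)), ?_⟩
      filter_upwards [eventually_forall_scaleFactor_le (η := η) hμne hB (half_pos hρ) hε]
        with N hN w hw
      refine (hN w fun z hz => hη z ?_).2
      rw [Metric.mem_ball, Real.dist_eq] at hw
      calc |z - y| ≤ |z - w| + |w - y| := abs_sub_le _ _ _
        _ < ρ := by linarith
  refine ⟨fun y hy => ⟨fun N M hN hNM => ?_, ?_, ?_⟩,
    fun K hKI hK ε hε => eventually_atTop.1 (hunif K hKI hK ε hε)⟩
  · refine csSup_le_csSup (hbdd N hN y hy) ⟨0, zero_mem_scaleFactor_set η μ M y⟩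
      fun a ha => ⟨ha.1, ha.2.trans ?_⟩
    gcongr
  · refine Metric.tendsto_nhds.2 fun ε hε => ?_
    filter_upwards [hunif {y} (by simpa using hy) isCompact_singleton (ε / 2) (half_pos hε)]
      with N hN
    rw [Real.dist_eq, sub_zero, abs_of_nonneg (scaleFactor_nonneg η μ N y)]
    linarith [hN y rfl]
  · have hV : ∫⁻ x, ENNReal.ofReal (x ^ 2) ∂μ ≠ 0 := by
      rw [← iSup_truncSecondMoment]
      exact fun h0 => truncSecondMoment_ne_zero hμne one_ne_zero (ENNReal.iSup_eq_zero.1 h0 1)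
    have hL : limsup (fun z => ENNReal.ofReal (η z ^ 2)) (𝓝 y) ≠ ⊤ := by
      obtain ⟨ρ, hρ, B, hB, hη⟩ := hloc y hy
      refine ne_top_of_le_ne_top (b := ENNReal.ofReal B) ENNReal.ofReal_ne_top
        (limsup_le_of_le (by isBoundedDefault) ?_)
      filter_upwards [Metric.ball_mem_nhds y hρ] with z hz
      exact ENNReal.ofReal_le_ofReal (hη z (by rwa [Metric.mem_ball, Real.dist_eq] at hz))
    rw [ENNReal.le_div_iff_mul_le (Or.inl hV) (Or.inr hL)]
    refine le_of_forall_gt_imp_ge_of_dense fun b hb => ?_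
    rcases eq_or_ne b ⊤ with rfl | hbtop
    · exact le_top
    obtain ⟨ρ, hρ, hρη⟩ := Metric.eventually_nhds_iff.1 (eventually_lt_of_limsup_lt hb)
    have hb0 : 0 < b.toReal := ENNReal.toReal_pos (pos_of_gt hb).ne' hbtop
    rw [← iSup_truncSecondMoment, ENNReal.mul_iSup, ← ENNReal.ofReal_toReal hbtop]
    refine iSup_le fun n => limsup_scaleFactor_mul_truncSecondMoment_le hμne hb0 (half_pos hρ)
      (fun z hz => ?_) (fun N hN => hbdd N hN y hy) n
    rw [← ENNReal.ofReal_le_iff_le_toReal hbtop]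
    exact (hρη (by rw [Real.dist_eq]; linarith)).le
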